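/- Let π: GL(n,ℝ) → Sym⁺⁺(n) be defined by π(A) = (α² A Aᵀ)^{1/(2α)} for fixed α ≠ 0. Then at each A₀ ∈ GL(n,ℝ), the kernel of the differential Dπ(A₀) equals {X : X A₀ᵀ is skew-symmetric} = (Sym(n))^⊥ (A₀ᵀ)⁻¹, and its orthogonal complement in M(n,ℝ) with respect to the Frobenius inner product equals Sym(n)·A₀. In particular, Dπ(A₀) is surjective onto Sym(n). -/

import Mathlib

open Matrix
open Classical in
/-- The real power `M ^ r` of a symmetric real matrix, defined through the spectral
functional calculus: `M ^ r = U diag(λᵢ^r) Uᵀ` (with `0 ^ r = 0` for `r > 0`).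
Junk value `0` if `M` is not symmetric. -/
noncomputable def matPow {n : ℕ} (M : Matrix (Fin n) (Fin n) ℝ) (r : ℝ) :
    Matrix (Fin n) (Fin n) ℝ :=
  if h : M.IsHermitian then
    (h.eigenvectorUnitary : Matrix (Fin n) (Fin n) ℝ) *
      Matrix.diagonal (fun i => h.eigenvalues i ^ r) *
      (star h.eigenvectorUnitary : Matrix (Fin n) (Fin n) ℝ)
  else 0

/-- The Frobenius inner product on real matrices. -/
def frobInner {n : ℕ} (M N : Matrix (Fin n) (Fin n) ℝ) : ℝ := ∑ i, ∑ j, M i j * N i j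

attribute [local instance] Matrix.frobeniusNormedAddCommGroup Matrix.frobeniusNormedSpace

namespace NormedSpace

open Topology

variable {A : Type*} [NormedRing A] [NormedAlgebra ℝ A]

theorem hasFDerivAt_exp_apply_of_commute [CompleteSpace A] {H X : A} {L : A →L[ℝ] A}
    (hL : HasFDerivAt exp L H) (hX : Commute H X) : L X = exp H * X := by
  have hline : HasDerivAt (fun t : ℝ => H + t • X) X 0 := by
    simpa using ((hasDerivAt_id (0 : ℝ)).smul_const X).const_add H
  have hcomp : HasDerivAt (fun t : ℝ => exp (H + t • X)) (L X) 0 :=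
    HasFDerivAt.comp_hasDerivAt (0 : ℝ) (by simpa using hL) hline
  have hprod : HasDerivAt (fun t : ℝ => exp H * exp (t • X)) (exp H * X) 0 := by
    simpa using (hasDerivAt_exp_smul_const (𝕂 := ℝ) X 0).const_mul (exp H)
  refine hcomp.unique (hprod.congr_of_eventuallyEq (.of_forall fun t => ?_))
  exact exp_add_of_commute_of_mem_ball (𝕂 := ℝ) (hX.smul_right t)
    ((expSeries_radius_eq_top ℝ A).symm ▸ edist_lt_top _ _)
    ((expSeries_radius_eq_top ℝ A).symm ▸ edist_lt_top _ _)

theorem hasFDerivAt_exp_commutator {H X : A} {L : A →L[ℝ] A}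
    (hL : HasFDerivAt exp L H) : X * exp H + H * L X = exp H * X + L X * H := by
  have hleft := (hasFDerivAt_id (𝕜 := ℝ) H).mul' hL
  have hright := hL.mul' (hasFDerivAt_id (𝕜 := ℝ) H)
  have heq : (id * exp : A → A) = exp * id :=
    funext fun Y => ((Commute.refl Y).exp_right (𝔸 := A)).eq
  have := DFunLike.congr_fun ((heq ▸ hleft).unique hright) X
  simpa [add_comm] using this

variable [StarRing A] [ContinuousFunctionalCalculus ℝ A IsSelfAdjoint]

theorem commute_of_commute_exp {H X : A} (hH : IsSelfAdjoint H)
    (hX : Commute (exp H) X) : Commute H X := by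
  have := hX.cfc_real Real.log
  rwa [← CFC.log, CFC.log_exp H] at this

theorem exists_hasStrictFDerivAt_exp [FiniteDimensional ℝ A] [StarModule ℝ A]
    [ContinuousStar A] {H : A} (hH : IsSelfAdjoint H) :
    ∃ e : A ≃L[ℝ] A, HasStrictFDerivAt exp (e : A →L[ℝ] A) H ∧ ∀ X, e (star X) = star (e X) := by
  have : CompleteSpace A := FiniteDimensional.complete ℝ A
  obtain ⟨L, hL⟩ : ∃ L : A →L[ℝ] A, HasStrictFDerivAt exp L H :=
    ⟨_, (exp_analytic (𝕂 := ℝ) H).hasStrictFDerivAt⟩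
  have hinj : Function.Injective L := by
    refine (injective_iff_map_eq_zero L).2 fun X hX => ?_
    have hcomm := hasFDerivAt_exp_commutator hL.hasFDerivAt (X := X)
    simp only [hX, mul_zero, add_zero, zero_mul] at hcomm
    have := hasFDerivAt_exp_apply_of_commute hL.hasFDerivAt
      (commute_of_commute_exp hH (X := X) hcomm.symm)
    exact ((isUnit_exp_of_mem_ball (𝕂 := ℝ)
      ((expSeries_radius_eq_top ℝ A).symm ▸ edist_lt_top H 0)).mul_right_eq_zero).1 (this ▸ hX)
  let e : A ≃L[ℝ] A := (LinearEquiv.ofInjectiveEndo (L : A →ₗ[ℝ] A) hinj).toContinuousLinearEquiv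
  have he : (e : A →L[ℝ] A) = L := by ext; rfl
  refine ⟨e, he ▸ hL, fun X => ?_⟩
  let S : A ≃L[ℝ] A := starL' ℝ
  have hS : HasFDerivAt (fun Y => star (exp (star Y)))
      (((S : A →L[ℝ] A).comp L).comp (S : A →L[ℝ] A)) H := by
    have h := (S : A →L[ℝ] A).hasFDerivAt.comp H
      (HasFDerivAt.comp H (g := exp) (f := S) (g' := L) (by
        have : S H = H := hH
        rw [this]; exact hL.hasFDerivAt) S.hasFDerivAt)
    exact h
  have heq : (fun Y : A => star (exp (star Y))) = exp := by
    funext Y; rw [star_exp, star_star]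
  have := DFunLike.congr_fun ((heq ▸ hS).unique hL.hasFDerivAt) X
  change star (L (star X)) = L X at this
  change L (star X) = star (L X)
  rw [← this, star_star]

theorem cfc_rpow_exp [StarModule ℝ A] {H : A} (hH : IsSelfAdjoint H) (r : ℝ) :
    cfc (fun x : ℝ => x ^ r) (exp H) = exp (r • H) := by
  have hcont : ContinuousOn (fun x : ℝ => x ^ r) (Real.exp '' spectrum ℝ H) := by
    rintro _ ⟨x, -, rfl⟩
    exact (Real.continuousAt_rpow_const _ _ (.inl (Real.exp_pos x).ne')).continuousWithinAt
  rw [← CFC.real_exp_eq_normedSpace_exp hH, ← cfc_comp' _ Real.exp H hcont,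
    ← CFC.real_exp_eq_normedSpace_exp (.smul (.all r) hH), ← cfc_comp_smul r Real.exp H]
  simp [← Real.exp_mul, mul_comm]

theorem exists_hasStrictFDerivAt_eventuallyEq_cfc_rpow [FiniteDimensional ℝ A]
    [StarModule ℝ A] [ContinuousStar A] {H E : A} (hH : IsSelfAdjoint H)
    (hE : exp H = E) {r : ℝ} (hr : r ≠ 0) :
    ∃ (g : A → A) (e : A ≃L[ℝ] A), HasStrictFDerivAt g (e : A →L[ℝ] A) E ∧
      (∀ X, e (star X) = star (e X)) ∧
      ∀ᶠ M in 𝓝 E, IsSelfAdjoint M → cfc (fun x : ℝ => x ^ r) M = g M := by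
  subst hE
  have : CompleteSpace A := FiniteDimensional.complete ℝ A
  obtain ⟨e₁, he₁, hs₁⟩ := exists_hasStrictFDerivAt_exp hH
  obtain ⟨e₂, he₂, hs₂⟩ := exists_hasStrictFDerivAt_exp (IsSelfAdjoint.smul (.all r) hH)
  let ℓ := he₁.localInverse exp e₁ H
  have hℓH : ℓ (exp H) = H := he₁.localInverse_apply_image
  have hℓ : HasStrictFDerivAt ℓ (e₁.symm : A →L[ℝ] A) (exp H) := he₁.to_localInverse
  have hcont : ContinuousAt ℓ (exp H) := he₁.localInverse_continuousAt
  let m : A ≃L[ℝ] A := ContinuousLinearEquiv.smulLeft (Units.mk0 r hr)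
  refine ⟨fun M => exp (r • ℓ M), (e₁.symm.trans m).trans e₂, ?_, fun X => ?_, ?_⟩
  · have h := HasStrictFDerivAt.comp (exp H) (g := exp) (f := fun M => r • ℓ M)
      (g' := (e₂ : A →L[ℝ] A)) (by simpa only [hℓH] using he₂) (hℓ.const_smul r)
    exact h
  · have hsymm : e₁.symm (star X) = star (e₁.symm X) := by
      rw [e₁.symm_apply_eq, hs₁, e₁.apply_symm_apply]
    change e₂ (r • e₁.symm (star X)) = star (e₂ (r • e₁.symm X))
    rw [hsymm, ← hs₂, star_smul, star_trivial r]
  · have hstar : Filter.Tendsto (fun M => star (ℓ M)) (𝓝 (exp H)) (𝓝 H) := by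
      have h := hcont.star.tendsto
      rwa [hℓH, hH.star_eq] at h
    filter_upwards [he₁.eventually_right_inverse, hstar.eventually he₁.eventually_left_inverse]
      with M hM hM' hsa
    have hsaℓ : IsSelfAdjoint (ℓ M) := by
      rw [← star_exp, hM, hsa.star_eq] at hM'
      exact hM'.symm
    rw [← cfc_rpow_exp hsaℓ, hM]

end NormedSpace

/-- The real continuous functional calculus of selfadjoint elements, for the norm topology. -/
abbrev NormedSelfAdjointCalculus (A : Type*) [NormedRing A] [NormedAlgebra ℝ A] [StarRing A] :
    Prop :=
  ContinuousFunctionalCalculus ℝ A IsSelfAdjoint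

section FrobeniusMatrix

open Topology NormedSpace
open scoped MatrixOrder

attribute [local instance] Matrix.frobeniusNormedRing Matrix.frobeniusNormedAlgebra

variable {n : ℕ}

theorem matPow_eq_cfc {M : Matrix (Fin n) (Fin n) ℝ} (hM : M.IsHermitian) (r : ℝ) :
    matPow M r = cfc (fun x : ℝ => x ^ r) M := by
  rw [hM.cfc_eq, matPow, dif_pos hM]
  rfl

theorem isHermitian_smul_mul_transpose (c : ℝ) (A : Matrix (Fin n) (Fin n) ℝ) :
    (c • (A * Aᵀ)).IsHermitian := by
  simp [Matrix.IsHermitian]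

theorem posDef_smul_mul_transpose {c : ℝ} (hc : 0 < c) {A : Matrix (Fin n) (Fin n) ℝ}
    (hA : IsUnit A) : (c • (A * Aᵀ)).PosDef := by
  simpa using (Matrix.PosDef.mul_conjTranspose_self A
    (Matrix.vecMul_injective_of_isUnit hA)).smul hc

theorem exists_fderiv_matPow {α : ℝ} (hα : α ≠ 0) {A₀ : Matrix (Fin n) (Fin n) ℝ}
    (hA₀ : IsUnit A₀) :
    ∃ e : Matrix (Fin n) (Fin n) ℝ ≃ₗ[ℝ] Matrix (Fin n) (Fin n) ℝ, (∀ X, e Xᵀ = (e X)ᵀ) ∧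
      ∀ X, fderiv ℝ (fun A : Matrix (Fin n) (Fin n) ℝ =>
        matPow ((α ^ 2) • (A * Aᵀ)) (1 / (2 * α))) A₀ X = e (X * A₀ᵀ + A₀ * Xᵀ) := by
  have : NormedSelfAdjointCalculus (Matrix (Fin n) (Fin n) ℝ) :=
    Matrix.IsHermitian.instContinuousFunctionalCalculus
  set E : Matrix (Fin n) (Fin n) ℝ := (α ^ 2) • (A₀ * A₀ᵀ)
  have hexp : exp (CFC.log E) = E :=
    CFC.exp_log E (posDef_smul_mul_transpose (by positivity) hA₀).isStrictlyPositive
  obtain ⟨g, e, hg, hes, hge⟩ := exists_hasStrictFDerivAt_eventuallyEq_cfc_rpow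
    (IsSelfAdjoint.log (a := E)) hexp (r := 1 / (2 * α)) (by positivity)
  let T : Matrix (Fin n) (Fin n) ℝ →L[ℝ] Matrix (Fin n) (Fin n) ℝ :=
    (Matrix.transposeLinearEquiv (Fin n) (Fin n) ℝ ℝ).toLinearMap.toContinuousLinearMap
  have hq := ((hasFDerivAt_id (𝕜 := ℝ) A₀).mul' (T.hasFDerivAt (x := A₀))).const_smul (α ^ 2)
  have hcont : ContinuousAt (fun A : Matrix (Fin n) (Fin n) ℝ => (α ^ 2) • (A * Aᵀ)) A₀ :=
    hq.continuousAt
  have hcomp := HasFDerivAt.comp A₀ (g := g) (f := fun A => (α ^ 2) • (A * Aᵀ))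
    hg.hasFDerivAt hq
  have heq : (fun A : Matrix (Fin n) (Fin n) ℝ => matPow ((α ^ 2) • (A * Aᵀ)) (1 / (2 * α)))
      =ᶠ[𝓝 A₀] fun A => g ((α ^ 2) • (A * Aᵀ)) := by
    filter_upwards [hcont.eventually hge] with A hA
    have hherm := isHermitian_smul_mul_transpose (α ^ 2) A
    exact (matPow_eq_cfc hherm _).trans (hA hherm)
  refine ⟨(LinearEquiv.smulOfNeZero ℝ _ (α ^ 2) (by positivity)).trans e.toLinearEquiv,
    fun X => ?_, fun X => ?_⟩
  · change e ((α ^ 2) • Xᵀ) = (e ((α ^ 2) • X))ᵀ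
    have := hes ((α ^ 2) • X)
    simpa [Matrix.star_eq_conjTranspose] using this
  · have := (hcomp.congr_of_eventuallyEq heq).fderiv
    refine (DFunLike.congr_fun this X).trans ?_
    change e ((α ^ 2) • (A₀ * Xᵀ + X * A₀ᵀ)) = e ((α ^ 2) • (X * A₀ᵀ + A₀ * Xᵀ))
    rw [add_comm]

end FrobeniusMatrix

theorem frobInner_eq_trace {n : ℕ} (M N : Matrix (Fin n) (Fin n) ℝ) :
    frobInner M N = (M * Nᵀ).trace := by
  simp [frobInner, Matrix.trace, Matrix.mul_apply]

theorem trace_mul_eq_zero_of_transpose_eq_neg {n : ℕ} {H K : Matrix (Fin n) (Fin n) ℝ}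
    (hH : Hᵀ = H) (hK : Kᵀ = -K) : (H * K).trace = 0 := by
  have h := Matrix.trace_transpose (H * K)
  rw [Matrix.transpose_mul, hH, hK, Matrix.neg_mul, Matrix.trace_neg, Matrix.trace_mul_comm] at h
  linarith

/-- For `π(A) = (α² A Aᵀ)^{1/(2α)}` and invertible `A₀`: the kernel of `Dπ(A₀)` is
`{X : X A₀ᵀ is skew-symmetric}`, its Frobenius-orthogonal complement is `Sym(n)·A₀`, and
`Dπ(A₀)` is surjective onto the symmetric matrices. -/
theorem stmt11 {n : ℕ} (α : ℝ) (hα : α ≠ 0) (A₀ : Matrix (Fin n) (Fin n) ℝ)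
    (hA₀ : IsUnit A₀) :
    ({X : Matrix (Fin n) (Fin n) ℝ |
        fderiv ℝ (fun A : Matrix (Fin n) (Fin n) ℝ =>
          matPow ((α ^ 2) • (A * Aᵀ)) (1 / (2 * α))) A₀ X = 0}
      = {X : Matrix (Fin n) (Fin n) ℝ | (X * A₀ᵀ)ᵀ = -(X * A₀ᵀ)}) ∧
    ({X : Matrix (Fin n) (Fin n) ℝ | ∀ Z : Matrix (Fin n) (Fin n) ℝ,
        fderiv ℝ (fun A : Matrix (Fin n) (Fin n) ℝ =>
          matPow ((α ^ 2) • (A * Aᵀ)) (1 / (2 * α))) A₀ Z = 0 → frobInner X Z = 0}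
      = {X : Matrix (Fin n) (Fin n) ℝ | ∃ H : Matrix (Fin n) (Fin n) ℝ, Hᵀ = H ∧ X = H * A₀}) ∧
    (∀ Y : Matrix (Fin n) (Fin n) ℝ, Yᵀ = Y →
      ∃ X : Matrix (Fin n) (Fin n) ℝ,
        fderiv ℝ (fun A : Matrix (Fin n) (Fin n) ℝ =>
          matPow ((α ^ 2) • (A * Aᵀ)) (1 / (2 * α))) A₀ X = Y) := by
  
  obtain ⟨e, hes, he⟩ := exists_fderiv_matPow hα hA₀
  have hdet : IsUnit A₀.det := (Matrix.isUnit_iff_isUnit_det A₀).1 hA₀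
  have hker : ∀ X : Matrix (Fin n) (Fin n) ℝ,
      fderiv ℝ (fun A : Matrix (Fin n) (Fin n) ℝ =>
        matPow ((α ^ 2) • (A * Aᵀ)) (1 / (2 * α))) A₀ X = 0 ↔ (X * A₀ᵀ)ᵀ = -(X * A₀ᵀ) := by
    intro X
    rw [he, e.map_eq_zero_iff, Matrix.transpose_mul, Matrix.transpose_transpose, add_comm,
      add_eq_zero_iff_eq_neg]
  have hcancel : ∀ K : Matrix (Fin n) (Fin n) ℝ, K * A₀ᵀ⁻¹ * A₀ᵀ = K := fun K =>
    Matrix.nonsing_inv_mul_cancel_right _ _ (by rwa [Matrix.det_transpose])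
  refine ⟨Set.ext hker, Set.ext fun X => ⟨fun hX => ?_, ?_⟩, fun Y hY => ?_⟩
  · obtain ⟨W, hXW⟩ : ∃ W, X = W * A₀ :=
      ⟨X * A₀⁻¹, (Matrix.nonsing_inv_mul_cancel_right _ _ hdet).symm⟩
    have hskew : (W - Wᵀ)ᵀ = -(W - Wᵀ) := by simp
    have hortho := hX ((W - Wᵀ) * A₀ᵀ⁻¹) ((hker _).2 (by rw [hcancel, hskew]))
    have hW0 : (W * (W - Wᵀ)ᵀ).trace = 0 := by
      rw [← hortho, frobInner_eq_trace, hXW, Matrix.mul_assoc]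
      congr 2
      rw [← Matrix.transpose_inj, Matrix.transpose_mul, Matrix.transpose_transpose,
        Matrix.transpose_transpose, hcancel]
    have hWt : (Wᵀ * (W - Wᵀ)ᵀ).trace = -(W * (W - Wᵀ)ᵀ).trace := by
      rw [← Matrix.trace_transpose, Matrix.transpose_mul, Matrix.transpose_transpose,
        Matrix.transpose_transpose, Matrix.trace_mul_comm, hskew, Matrix.mul_neg, Matrix.trace_neg,
        neg_neg]
    have hzero : ((W - Wᵀ) * (W - Wᵀ)ᴴ).trace = 0 := by
      rw [Matrix.conjTranspose_eq_transpose_of_trivial, Matrix.sub_mul, Matrix.trace_sub, hWt, hW0]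
      simp
    exact ⟨W, (sub_eq_zero.1 (Matrix.trace_mul_conjTranspose_self_eq_zero_iff.1 hzero)).symm, hXW⟩
  · rintro ⟨H, hH, rfl⟩ Z hZ
    rw [frobInner_eq_trace, Matrix.mul_assoc]
    refine trace_mul_eq_zero_of_transpose_eq_neg hH ?_
    have h := (hker Z).1 hZ
    rw [Matrix.transpose_mul, Matrix.transpose_transpose] at h ⊢
    rw [h, neg_neg]
  · have hS : (e.symm Y)ᵀ = e.symm Y := by
      rw [e.eq_symm_apply, hes, e.apply_symm_apply, hY]
    refine ⟨((1 / 2 : ℝ) • e.symm Y) * A₀ᵀ⁻¹, ?_⟩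
    have hA₀X : ∀ X : Matrix (Fin n) (Fin n) ℝ, A₀ * Xᵀ = (X * A₀ᵀ)ᵀ := fun X => by
      rw [Matrix.transpose_mul, Matrix.transpose_transpose]
    rw [he, hA₀X, hcancel, Matrix.transpose_smul, hS, ← add_smul]
    norm_num
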